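/- Let a : Fin d → MvPolynomial (Fin d) ℝ be a twn-update with induced map α, and let the guard S ⊆ (Fin d → ℝ) be a finite union of finite intersections of sets of the form {x | eval x p > 0} or {x | eval x p ≥ 0} with p ∈ MvPolynomial (Fin d) ℝ. Assume that every coefficient of every a i and of every polynomial p occurring in the description of S is algebraic over ℚ. Then there exists c : Fin d → ℝ with α^[n](c) ∈ S for all n ∈ ℕ if and only if there exists such a c all of whose coordinates c i are algebraic over ℚ. In other words, the twn-loop terminates over the real algebraic numbers if and only if it terminates over ℝ. -/

import Mathlib

open MvPolynomial

/-- The dependence relation `≻_a`: transitive closure of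
`{(i, j) | i ≠ j and j ∈ (a i).vars}`. -/
def depRel {d : ℕ} (a : Fin d → MvPolynomial (Fin d) ℝ) : Fin d → Fin d → Prop :=
  Relation.TransGen fun i j => i ≠ j ∧ j ∈ (a i).vars

/-- The map on points induced by an update: `α(c) i = eval c (a i)`. -/
noncomputable def updMap {d : ℕ} (a : Fin d → MvPolynomial (Fin d) ℝ)
    (c : Fin d → ℝ) (i : Fin d) : ℝ :=
  eval c (a i)

/-- A guard in disjunctive normal form all of whose defining polynomials have coefficients
that are algebraic over ℚ: a finite union of finite intersections of sets of the form
`{x | eval x p > 0}` or `{x | eval x p ≥ 0}`. -/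
def IsAlgDNFGuard {d : ℕ} (S : Set (Fin d → ℝ)) : Prop :=
  ∃ (m : ℕ) (k : Fin m → ℕ) (p : (i : Fin m) → Fin (k i) → MvPolynomial (Fin d) ℝ)
    (strict : (i : Fin m) → Fin (k i) → Bool),
    (∀ (i : Fin m) (j : Fin (k i)) (mono : Fin d →₀ ℕ),
      IsAlgebraic ℚ (coeff mono (p i j))) ∧
    S = ⋃ i, ⋂ j, {x | if strict i j then 0 < eval x (p i j) else 0 ≤ eval x (p i j)}


/-- The field of real algebraic numbers. -/
noncomputable abbrev RA : IntermediateField ℚ ℝ := algebraicClosure ℚ ℝ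

/-- The functions on `B` that come from homomorphisms to the real algebraic numbers. -/
def homSet (B : Subalgebra RA ℝ) : Set (B → ℝ) :=
  {g | ∃ ψ : B →ₐ[RA] ℝ, (∀ b, ψ b ∈ RA) ∧ g = ψ}

def ALprop (B : Subalgebra RA ℝ) : Prop := (fun b : B => (b : ℝ)) ∈ closure (homSet B)

lemma RA_of_isAlgebraic {x : ℝ} (h : IsAlgebraic RA x) : x ∈ RA := by
  have : Algebra.IsAlgebraic ℚ (algebraicClosure ℚ ℝ) := algebraicClosure.isAlgebraic ℚ ℝ
  have : IsAlgebraic ℚ x := h.restrictScalars ℚ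
  exact (mem_algebraicClosure_iff).2 this

/-- value of a polynomial when coefficients are moved by `g`. -/
noncomputable def pev {B : Subalgebra RA ℝ} (q : Polynomial B) (g : B → ℝ) (y : ℝ) : ℝ :=
  ∑ k ∈ q.support, g (q.coeff k) * y ^ k

lemma pev_cont {B : Subalgebra RA ℝ} (q : Polynomial B) :
    Continuous (fun z : (B → ℝ) × ℝ => pev q z.1 z.2) := by
  unfold pev
  fun_prop

lemma pev_hom {B : Subalgebra RA ℝ} (q : Polynomial B) (ψ : B →ₐ[RA] ℝ) (y : ℝ) :
    pev q ψ y = q.eval₂ (ψ : B →+* ℝ) y := by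
  simp [pev, Polynomial.eval₂_eq_sum, Polynomial.sum]

lemma pev_val {B : Subalgebra RA ℝ} (q : Polynomial B) (y : ℝ) :
    pev q (fun b => (b : ℝ)) y = Polynomial.aeval y q := by
  simp [pev, Polynomial.aeval_def, Polynomial.eval₂_eq_sum, Polynomial.sum]

lemma hom_eq_of_ker {R : Type*} [CommRing R] (π ev : R →+* ℝ) (h : ∀ f, π f = 0 → ev f = 0)
    (f g : R) (hfg : π f = π g) : ev f = ev g := by
  have h1 := h (f - g) (by rw [map_sub, hfg, sub_self])
  rw [map_sub] at h1
  linarith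

lemma lift_hom (S T : Subalgebra RA ℝ) (x : ℝ) (ψ : S →ₐ[RA] ℝ) (hψ : ∀ b, ψ b ∈ RA)
    (x' : ℝ) (hx' : x' ∈ RA)
    (hz : ∀ f : Polynomial S, Polynomial.aeval x f = 0 → f.eval₂ (ψ : S →+* ℝ) x' = 0)
    (q : T → Polynomial S)
    (hq : ∀ t, Polynomial.aeval x (q t) = (t : ℝ)) :
    (fun t => pev (q t) ψ x') ∈ homSet T := by
  obtain ⟨ev, hev⟩ : ∃ ev : Polynomial S →+* ℝ, ∀ f, ev f = f.eval₂ (ψ : S →+* ℝ) x' :=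
    ⟨Polynomial.eval₂RingHom (ψ : S →+* ℝ) x', fun f => rfl⟩
  obtain ⟨π, hπ⟩ : ∃ π : Polynomial S →+* ℝ, ∀ f, π f = Polynomial.aeval x f :=
    ⟨(Polynomial.aeval x : Polynomial S →ₐ[S] ℝ).toRingHom, fun f => rfl⟩
  have hq' : ∀ t, π (q t) = (t : ℝ) := fun t => (hπ _).trans (hq t)
  have key : ∀ f g : Polynomial S, π f = π g → ev f = ev g := by
    exact hom_eq_of_ker π ev fun f hf => (hev f).trans (hz f ((hπ f).symm.trans hf))
  let χ : T →+* ℝ :=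
    { toFun := fun t => ev (q t)
      map_one' := by rw [key (q 1) 1 (by rw [hq', map_one]; rfl), map_one]
      map_mul' := fun s t => by
        rw [key (q (s * t)) (q s * q t) (by rw [hq', map_mul, hq', hq']; rfl), map_mul]
      map_zero' := by rw [key (q 0) 0 (by rw [hq', map_zero]; rfl), map_zero]
      map_add' := fun s t => by
        rw [key (q (s + t)) (q s + q t) (by rw [hq', map_add, hq', hq']; rfl), map_add] }
  have hχ : ∀ t, χ t = ev (q t) := fun t => rfl
  refine ⟨{ χ with commutes' := ?_ }, ?_, ?_⟩
  · intro r
    show χ _ = _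
    rw [hχ, key (q _) (Polynomial.C (algebraMap RA S r)) (by
      rw [hq', hπ, Polynomial.aeval_C]; rfl), hev, Polynomial.eval₂_C]
    exact ψ.commutes r
  · intro t
    show χ t ∈ RA
    rw [hχ, hev, Polynomial.eval₂_eq_sum, Polynomial.sum]
    exact sum_mem fun k _ => mul_mem (hψ _) (pow_mem hx' _)
  · funext t
    show _ = χ t
    rw [hχ, hev]
    exact pev_hom _ _ _

/-- zero propagation through a minimal polynomial -/
lemma minimal_zero (S : Subalgebra RA ℝ) (x : ℝ) (P : Polynomial S) (hP : P ≠ 0)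
    (hPx : Polynomial.aeval x P = 0)
    (hmin : ∀ f : Polynomial S, f ≠ 0 → Polynomial.aeval x f = 0 → P.natDegree ≤ f.natDegree)
    (ψ : S →ₐ[RA] ℝ) (x' : ℝ) (hlc : ψ P.leadingCoeff ≠ 0)
    (hz : P.eval₂ (ψ : S →+* ℝ) x' = 0) :
    ∀ (n : ℕ) (f : Polynomial S), f.natDegree < n → Polynomial.aeval x f = 0 →
      f.eval₂ (ψ : S →+* ℝ) x' = 0 := by
  intro n
  induction n with
  | zero => intro f hf; omega
  | succ n ih =>
    intro f hf hfx
    by_cases hf0 : f = 0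
    · simp [hf0]
    have hle := hmin f hf0 hfx
    have hPpos : 0 < P.natDegree := by
      by_contra h
      have h0 : P.natDegree = 0 := by omega
      rw [Polynomial.eq_C_of_natDegree_eq_zero h0] at hPx hP
      simp at hPx
      apply hP
      rw [Polynomial.C_eq_zero]
      exact hPx
    set A := Polynomial.C P.leadingCoeff * f with hA
    set Q := Polynomial.C f.leadingCoeff * Polynomial.X ^ (f.natDegree - P.natDegree) * P with hQ
    have hlP : P.leadingCoeff ≠ 0 := by simpa using hP
    have hlf : f.leadingCoeff ≠ 0 := by simpa using hf0
    have hA0 : A ≠ 0 := by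
      rw [hA]; exact mul_ne_zero (by simpa using hP) hf0
    have hdA : A.degree = f.degree := by
      rw [hA, Polynomial.degree_C_mul hlP]
    have hdQ : Q.degree = f.degree := by
      rw [hQ, Polynomial.degree_mul, Polynomial.degree_C_mul_X_pow _ hlf,
        Polynomial.degree_eq_natDegree hP, Polynomial.degree_eq_natDegree hf0]
      norm_cast
      omega
    have hlt := Polynomial.degree_sub_lt_left (p := A) (q := Q) (hdA.trans hdQ.symm) hA0 (by
      rw [hA, hQ, Polynomial.leadingCoeff_mul, Polynomial.leadingCoeff_mul, Polynomial.leadingCoeff_C,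
        Polynomial.leadingCoeff_C_mul_X_pow, mul_comm])
    have hAQ : (A - Q).eval₂ (ψ : S →+* ℝ) x' = 0 := by
      by_cases h0 : A - Q = 0
      · simp [h0]
      apply ih
      · rw [hdA] at hlt
        have := Polynomial.natDegree_lt_natDegree h0 hlt
        omega
      · simp [hA, hQ, hfx, hPx]
    rw [Polynomial.eval₂_sub, hA, hQ, Polynomial.eval₂_mul, Polynomial.eval₂_mul, hz] at hAQ
    simp only [Polynomial.eval₂_C, mul_zero, sub_zero] at hAQ
    exact (mul_eq_zero.1 hAQ).resolve_left hlc

lemma AL_step (S : Subalgebra RA ℝ) (x : ℝ) (hS : ALprop S) :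
    ALprop (Algebra.adjoin RA (insert x (S : Set ℝ))) := by
  have hrep : ∀ t : (Algebra.adjoin RA (insert x (S : Set ℝ)) : Subalgebra RA ℝ),
      ∃ q : Polynomial S, Polynomial.aeval x q = (t : ℝ) := by
    rintro ⟨t, ht⟩
    have : Algebra.adjoin RA (insert x (S : Set ℝ)) ≤
        ((Polynomial.aeval x : Polynomial S →ₐ[S] ℝ).restrictScalars RA).range := by
      rw [Algebra.adjoin_le_iff]
      rintro y (rfl | hy)
      · exact ⟨Polynomial.X, by simp⟩
      · exact ⟨Polynomial.C ⟨y, hy⟩, by simp⟩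
    exact this ht
  choose q hq using hrep
  unfold ALprop
  rw [mem_closure_iff_nhds]
  intro U hU
  have hcont : Continuous (fun z : (S → ℝ) × ℝ => fun t => pev (q t) z.1 z.2) :=
    continuous_pi fun t => pev_cont (q t)
  have hval : (fun t => pev (q t) (fun b : S => (b : ℝ)) x) =
      (fun t : (Algebra.adjoin RA (insert x (S : Set ℝ)) : Subalgebra RA ℝ) => (t : ℝ)) := by
    funext t; rw [pev_val, hq]
  have hU' : ∀ᶠ z in nhds ((fun b : S => (b : ℝ)), x), (fun t => pev (q t) z.1 z.2) ∈ U := by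
    apply hcont.continuousAt.eventually_mem
    simpa only [hval] using hU
  rw [nhds_prod_eq, Filter.eventually_prod_iff] at hU'
  obtain ⟨pa, hpa, pb, hpb, hab⟩ := hU'
  have hfreq := mem_closure_iff_frequently.1 hS
  by_cases htr : ∃ f : Polynomial S, f ≠ 0 ∧ Polynomial.aeval x f = 0
  · -- algebraic case
    classical
    obtain ⟨P, ⟨hP, hPx⟩, hmin'⟩ := WellFounded.has_min
      (InvImage.wf (Polynomial.natDegree : Polynomial S → ℕ) Nat.lt_wfRel.wf)
      {f : Polynomial S | f ≠ 0 ∧ Polynomial.aeval x f = 0} htr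
    have hmin : ∀ f : Polynomial S, f ≠ 0 → Polynomial.aeval x f = 0 →
        P.natDegree ≤ f.natDegree := fun f h1 h2 => not_lt.1 (hmin' f ⟨h1, h2⟩)
    have hPpos : P.natDegree ≠ 0 := by
      intro h0
      rw [Polynomial.eq_C_of_natDegree_eq_zero h0] at hPx hP
      simp at hPx
      apply hP
      rw [Polynomial.C_eq_zero]
      exact hPx
    have hD : Polynomial.aeval x P.derivative ≠ 0 := by
      intro h
      have h1 : P.derivative ≠ 0 := by
        intro h0
        exact hPpos (Polynomial.derivative_eq_zero.1 h0)
      have := hmin _ h1 h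
      have := Polynomial.natDegree_derivative_lt hPpos
      omega
    set D := Polynomial.aeval x P.derivative
    have hder : HasDerivAt (fun y : ℝ => Polynomial.aeval y P) D x := P.hasDerivAt_aeval x
    have hslope := hasDerivAt_iff_tendsto_slope.1 hder
    have hsl : ∀ᶠ y in nhdsWithin x {x}ᶜ, 0 < slope (fun y : ℝ => Polynomial.aeval y P) x y * D := by
      have := hslope.mul_const D
      exact this.eventually (lt_mem_nhds (mul_self_pos.2 hD))
    rw [eventually_nhdsWithin_iff] at hsl
    obtain ⟨ε, hε, hball⟩ := Metric.eventually_nhds_iff.1 (hsl.and hpb)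
    have hsub : ∀ y, |y - x| < ε → y ≠ x → 0 < (Polynomial.aeval y P / (y - x)) * D := by
      intro y hy hne
      have := (hball (y := y) (by rwa [Real.dist_eq])).1 hne
      rw [slope_def_field, hPx, sub_zero] at this
      exact this
    set u := x - ε / 2
    set v := x + ε / 2
    have huv : Polynomial.aeval u P * Polynomial.aeval v P < 0 := by
      have h1 := hsub u (by simp only [u]; rw [abs_lt]; constructor <;> linarith) (by simp only [u]; linarith)
      have h2 := hsub v (by simp only [v]; rw [abs_lt]; constructor <;> linarith) (by simp only [v]; linarith)
      have e1 : u - x = -(ε / 2) := by simp [u]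
      have e2 : v - x = ε / 2 := by simp [v]
      rw [e1] at h1
      rw [e2] at h2
      have h3 := mul_pos h1 h2
      have h4 : (Polynomial.aeval u P / -(ε / 2)) * D * ((Polynomial.aeval v P / (ε / 2)) * D)
        = -(Polynomial.aeval u P * Polynomial.aeval v P) * (D / (ε / 2)) ^ 2 := by
        field_simp
      rw [h4] at h3
      have h5 : 0 < (D / (ε / 2)) ^ 2 := by positivity
      have := (pos_iff_pos_of_mul_pos h3).2 h5
      linarith
    have hc2 : Continuous (fun f : S → ℝ => pev P f u * pev P f v) :=
      ((pev_cont P).comp (Continuous.prodMk continuous_id continuous_const)).mul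
       ((pev_cont P).comp (Continuous.prodMk continuous_id continuous_const))
    have hev1 : ∀ᶠ f in nhds (fun b : S => (b : ℝ)), pev P f u * pev P f v < 0 := by
      apply hc2.continuousAt.eventually_lt continuousAt_const
      rw [pev_val, pev_val]; exact huv
    have hev2 : ∀ᶠ f in nhds (fun b : S => (b : ℝ)), f P.leadingCoeff ≠ 0 := by
      apply (continuous_apply P.leadingCoeff).continuousAt.eventually_ne
      intro h
      apply hP
      rw [← Polynomial.leadingCoeff_eq_zero]
      exact Subtype.ext h
    obtain ⟨f, ⟨ψ, hψ, rfl⟩, h1, h2, h3⟩ := (hfreq.and_eventually (hpa.and (hev1.and hev2))).exists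
    -- root
    have hcontP : Continuous (fun y => pev P ψ y) :=
      (pev_cont P).comp (Continuous.prodMk continuous_const continuous_id)
    have huv' : u ≤ v := by simp only [u, v]; linarith
    have hroot : ∃ x' ∈ Set.Icc u v, pev P ψ x' = 0 := by
      rcases mul_neg_iff.1 h2 with ⟨ha, hb⟩ | ⟨ha, hb⟩
      · exact intermediate_value_Icc' huv' hcontP.continuousOn ⟨hb.le, ha.le⟩
      · exact intermediate_value_Icc huv' hcontP.continuousOn ⟨ha.le, hb.le⟩
    obtain ⟨x', ⟨hx1, hx2⟩, hx'0⟩ := hroot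
    have hx'0' := hx'0
    rw [pev_hom] at hx'0
    have hpbx : pb x' := (hball (y := x') (by
      rw [Real.dist_eq, abs_lt]; simp only [u, v] at hx1 hx2; constructor <;> linarith)).2
    have hx'A : x' ∈ RA := by
      apply RA_of_isAlgebraic
      let ψ' : S →+* RA := (ψ : S →+* ℝ).codRestrict RA.toSubfield hψ
      refine ⟨P.map ψ', ?_, ?_⟩
      · intro h0
        have := congrArg (fun p => p.coeff P.natDegree) h0
        simp only [Polynomial.coeff_map, Polynomial.coeff_zero] at this
        exact h3 (congrArg Subtype.val this)
      · rw [Polynomial.aeval_def, Polynomial.eval₂_map]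
        exact hx'0
    refine ⟨_, hab h1 hpbx, ?_⟩
    exact lift_hom S _ x ψ hψ x' hx'A (fun f hf => minimal_zero S x P hP hPx hmin ψ x' h3 hx'0
      (f.natDegree + 1) f (by omega) hf) q hq
  · push Not at htr
    obtain ⟨f, ⟨ψ, hψ, rfl⟩, h1⟩ := (hfreq.and_eventually hpa).exists
    obtain ⟨ε, hε, hball⟩ := Metric.eventually_nhds_iff.1 hpb
    obtain ⟨r, hr⟩ := Rat.denseRange_cast.exists_dist_lt x hε
    refine ⟨_, hab h1 (hball (y := (r : ℝ)) (by rwa [dist_comm])), ?_⟩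
    refine lift_hom S _ x ψ hψ r ?_ (fun f hf => ?_) q hq
    · exact (RA.algebraMap_mem r)
    · by_cases h : f = 0
      · simp [h]
      · exact absurd hf (htr f h)

lemma AL_adjoin (s : Finset ℝ) : ALprop (Algebra.adjoin RA (s : Set ℝ)) := by
  classical
  induction s using Finset.induction_on with
  | empty =>
    apply subset_closure
    refine ⟨Subalgebra.val _, ?_, rfl⟩
    rintro ⟨b, hb⟩
    simp only [Finset.coe_empty, Algebra.adjoin_empty] at hb
    obtain ⟨y, rfl⟩ := Algebra.mem_bot.1 hb
    exact y.2
  | insert x s _ ih =>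
    have h := AL_step _ x ih
    have e : Algebra.adjoin RA (insert x ((Algebra.adjoin RA (s : Set ℝ) : Subalgebra RA ℝ) : Set ℝ))
        = Algebra.adjoin RA ((insert x s : Finset ℝ) : Set ℝ) := by
      rw [Finset.coe_insert, Set.insert_eq, Set.insert_eq, Algebra.adjoin_union,
        Algebra.adjoin_union, Algebra.adjoin_eq]
    rw [e] at h
    exact h


section PolyExp
variable {K B : Type*} [Field K] [CommRing B] [Algebra K B]

/-- The sequence `n ↦ b ^ n * n ^ k`. -/
def pe (B : Type*) [CommRing B] [Algebra K B] (b : K) (k : ℕ) : ℕ → B :=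
  fun n => algebraMap K B (b ^ n * (n : K) ^ k)

variable (K B) in
/-- The span of the basic poly-exponential sequences. -/
def peSpan : Submodule B (ℕ → B) := Submodule.span B {u | ∃ b : K, b ≠ 0 ∧ ∃ k, u = pe B b k}

lemma pe_mem {b : K} (hb : b ≠ 0) (k : ℕ) : pe B b k ∈ peSpan K B :=
  Submodule.subset_span ⟨b, hb, k, rfl⟩

lemma peSpan_mul {u v : ℕ → B} (hu : u ∈ peSpan K B) (hv : v ∈ peSpan K B) :
    u * v ∈ peSpan K B := by
  unfold peSpan at hu
  induction hu using Submodule.span_induction with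
  | zero => simp
  | add x y _ _ hx hy => rw [add_mul]; exact add_mem hx hy
  | smul a x _ hx => rw [smul_mul_assoc]; exact Submodule.smul_mem _ _ hx
  | mem x hx =>
    obtain ⟨b, hb, k, rfl⟩ := hx
    unfold peSpan at hv
    induction hv using Submodule.span_induction with
    | zero => simp
    | add x y _ _ hx hy => rw [mul_add]; exact add_mem hx hy
    | smul a x _ hx => rw [mul_smul_comm]; exact Submodule.smul_mem _ _ hx
    | mem x hx =>
      obtain ⟨b', hb', k', rfl⟩ := hx
      have : pe B b k * pe B b' k' = pe B (b * b') (k + k') := by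
        funext n
        simp only [pe, Pi.mul_apply, ← map_mul]
        congr 1
        ring
      rw [this]
      exact pe_mem (mul_ne_zero hb hb') _

lemma peSpan_const (z : B) : (fun _ => z) ∈ peSpan K B := by
  have : (fun _ => z) = z • pe B (1 : K) 0 := by
    funext n; simp [pe]
  rw [this]
  exact Submodule.smul_mem _ _ (pe_mem one_ne_zero 0)

/-- `u (n+1) - c * u n` as a linear operator. -/
def shiftOp (B : Type*) [CommRing B] [Algebra K B] (c : K) : (ℕ → B) →ₗ[B] (ℕ → B) where
  toFun u := fun n => u (n + 1) - algebraMap K B c * u n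
  map_add' u v := by funext n; simp; ring
  map_smul' r u := by funext n; simp; ring

lemma shiftOp_apply (c : K) (u : ℕ → B) (n : ℕ) :
    shiftOp B c u n = u (n + 1) - algebraMap K B c * u n := rfl

lemma shiftOp_pe (c b : K) (k : ℕ) :
    shiftOp B c (pe B b k) = algebraMap K B (b - c) • pe B b k +
      ∑ j ∈ Finset.range k, algebraMap K B (b * (k.choose j : K)) • pe B b j := by
  funext n
  simp only [shiftOp_apply, Pi.add_apply, Finset.sum_apply, Pi.smul_apply, smul_eq_mul, pe,
    ← map_mul, ← map_sub, ← map_sum, ← map_add]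
  congr 1
  push_cast
  rw [add_pow, Finset.sum_range_succ]
  simp only [one_pow, mul_one, Nat.choose_self, Nat.cast_one]
  rw [mul_add, Finset.mul_sum]
  have : ∀ j, b ^ (n + 1) * ((n : K) ^ j * (k.choose j : K)) =
    b * (k.choose j : K) * (b ^ n * (n : K) ^ j) := fun j => by ring
  simp only [this]
  ring

lemma pe_mem_image [CharZero K] (c : K) {b : K} (hb : b ≠ 0) (k : ℕ) :
    pe B b k ∈ (peSpan K B).map (shiftOp B c) := by
  induction k using Nat.strong_induction_on with
  | _ k ih =>
  have hdiv : ∀ (r : K) (u : ℕ → B), r ≠ 0 →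
      algebraMap K B r • u ∈ (peSpan K B).map (shiftOp B c) →
      u ∈ (peSpan K B).map (shiftOp B c) := by
    intro r u hr h
    have := Submodule.smul_mem _ (algebraMap K B r⁻¹) h
    rwa [smul_smul, ← map_mul, inv_mul_cancel₀ hr, map_one, one_smul] at this
  by_cases hbc : b = c
  · have h := shiftOp_pe (B := B) c b (k + 1)
    have hbc' : b - c = 0 := sub_eq_zero.2 hbc
    rw [Finset.sum_range_succ, hbc', map_zero, zero_smul, zero_add] at h
    refine hdiv (b * ((k + 1).choose k : K)) _ ?_ ?_
    · simp only [Nat.choose_succ_self_right]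
      exact mul_ne_zero hb (by exact_mod_cast Nat.succ_ne_zero k)
    · rw [← sub_eq_iff_eq_add'] at h
      rw [← h]
      refine sub_mem (Submodule.mem_map_of_mem (pe_mem hb _)) (sum_mem fun j hj => ?_)
      exact Submodule.smul_mem _ _ (ih j (Finset.mem_range.1 hj))
  · refine hdiv (b - c) _ (sub_ne_zero.2 hbc) ?_
    have h := shiftOp_pe (B := B) c b k
    rw [← sub_eq_iff_eq_add] at h
    rw [← h]
    refine sub_mem (Submodule.mem_map_of_mem (pe_mem hb _)) (sum_mem fun j hj => ?_)
    exact Submodule.smul_mem _ _ (ih j (Finset.mem_range.1 hj))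

lemma peSpan_solve [CharZero K] (c : K) {p : ℕ → B} (hp : p ∈ peSpan K B) :
    ∃ y ∈ peSpan K B, ∀ n, y (n + 1) = algebraMap K B c * y n + p n := by
  have : peSpan K B ≤ (peSpan K B).map (shiftOp B c) := by
    conv_lhs => unfold peSpan
    rw [Submodule.span_le]
    rintro _ ⟨b, hb, k, rfl⟩
    exact pe_mem_image c hb k
  obtain ⟨y, hy, hyp⟩ := this hp
  refine ⟨y, hy, fun n => ?_⟩
  rw [← hyp, shiftOp_apply]
  ring

variable (K B) in
/-- Sequences that are eventually poly-exponential. -/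
def PE : Subalgebra B (ℕ → B) where
  carrier := {u | ∃ v ∈ peSpan K B, ∀ᶠ n in Filter.atTop, u n = v n}
  mul_mem' := by
    rintro a b ⟨v, hv, h⟩ ⟨w, hw, h'⟩
    refine ⟨v * w, peSpan_mul hv hw, ?_⟩
    filter_upwards [h, h'] with n h1 h2
    simp [h1, h2]
  add_mem' := by
    rintro a b ⟨v, hv, h⟩ ⟨w, hw, h'⟩
    refine ⟨v + w, add_mem hv hw, ?_⟩
    filter_upwards [h, h'] with n h1 h2
    simp [h1, h2]
  algebraMap_mem' := fun r => ⟨_, peSpan_const r, Filter.Eventually.of_forall fun n => rfl⟩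

lemma PE_rec [CharZero K] (c : K) {p x : ℕ → B} (hp : p ∈ PE K B)
    (hx : ∀ n, x (n + 1) = algebraMap K B c * x n + p n) : x ∈ PE K B := by
  obtain ⟨p', hp', hpp⟩ := hp
  obtain ⟨N, hN⟩ := Filter.eventually_atTop.1 hpp
  obtain ⟨y, hy, hyp⟩ := peSpan_solve c hp'
  have hz : ∀ n, N ≤ n → x (n + 1) - y (n + 1) = algebraMap K B c * (x n - y n) := by
    intro n hn
    rw [hx, hyp, hN n hn]; ring
  by_cases hc : c = 0
  · refine ⟨y, hy, Filter.eventually_atTop.2 ⟨N + 1, fun n hn => ?_⟩⟩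
    obtain ⟨m, rfl⟩ : ∃ m, n = m + 1 := ⟨n - 1, by omega⟩
    have := hz m (by omega)
    rw [hc, map_zero, zero_mul] at this
    exact sub_eq_zero.1 this
  · have hzn : ∀ m, x (N + m) - y (N + m) = algebraMap K B (c ^ m) * (x N - y N) := by
      intro m
      induction m with
      | zero => simp
      | succ m ih =>
        rw [← add_assoc, hz _ (by omega), ih, ← mul_assoc, ← map_mul, pow_succ']
    refine ⟨y + (algebraMap K B (c⁻¹ ^ N) * (x N - y N)) • pe B c 0,
      add_mem hy (Submodule.smul_mem _ _ (pe_mem hc 0)),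
      Filter.eventually_atTop.2 ⟨N, fun n hn => ?_⟩⟩
    obtain ⟨m, rfl⟩ := Nat.exists_eq_add_of_le hn
    have e : algebraMap K B (c⁻¹ ^ N) * algebraMap K B (c ^ (N + m)) = algebraMap K B (c ^ m) := by
      rw [← map_mul]
      congr 1
      rw [pow_add, ← mul_assoc, ← mul_pow, inv_mul_cancel₀ hc]; simp
    simp only [Pi.add_apply, Pi.smul_apply, smul_eq_mul, pe, pow_zero, mul_one]
    rw [mul_right_comm, e, ← hzn]
    ring

lemma PE_aeval {σ : Type*} (w : σ → ℕ → B) (hw : ∀ i, w i ∈ PE K B) (p : MvPolynomial σ K) :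
    (fun n => aeval (fun i => w i n) p) ∈ PE K B := by
  induction p using MvPolynomial.induction_on with
  | C r => 
    simp only [aeval_C]
    exact (PE K B).algebraMap_mem (algebraMap K B r)
  | add p q hp hq => 
    simp only [map_add]
    exact add_mem hp hq
  | mul_X p i hp => 
    simp only [map_mul, aeval_X]
    exact mul_mem hp (hw i)

variable [Algebra K ℝ]

/-- Dominant term. -/
lemma dominant {ι : Type*} [DecidableEq ι] (s : Finset ι) (β : ι → ℝ) (κ : ι → ℕ) (f : ι → ℝ) (m : ι) (hm : m ∈ s)
    (hβ : ∀ i ∈ s, 0 < β i) (hlt : ∀ i ∈ s, i ≠ m → β i < β m ∨ (β i = β m ∧ κ i < κ m))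
    (hf : 0 < f m) :
    ∀ᶠ n : ℕ in Filter.atTop, 0 < ∑ i ∈ s, f i * (β i ^ n * (n : ℝ) ^ κ i) := by
  have hbm := hβ m hm
  have ho : (fun n : ℕ => ∑ i ∈ s.erase m, f i * (β i ^ n * (n : ℝ) ^ κ i)) =o[Filter.atTop]
      (fun n : ℕ => β m ^ n * (n : ℝ) ^ κ m) := by
    apply Asymptotics.IsLittleO.fun_sum
    intro i hi
    rw [Finset.mem_erase] at hi
    apply Asymptotics.IsLittleO.const_mul_left
    rcases hlt i hi.2 hi.1 with h | ⟨h1, h2⟩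
    · have h1 := isLittleO_pow_const_mul_const_pow_const_pow_of_norm_lt (R := ℝ) (κ i)
        (r₁ := β i) (r₂ := β m) (by rwa [Real.norm_of_nonneg (hβ i hi.2).le])
      have h2 : (fun n : ℕ => β m ^ n) =O[Filter.atTop]
          (fun n : ℕ => β m ^ n * (n : ℝ) ^ κ m) := by
        apply Asymptotics.IsBigO.of_bound 1
        filter_upwards [Filter.eventually_ge_atTop 1] with n hn
        have hn' : (1 : ℝ) ≤ (n : ℝ) := by exact_mod_cast hn
        rw [norm_mul, one_mul]
        apply le_mul_of_one_le_right (norm_nonneg _)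
        rw [norm_pow, Real.norm_of_nonneg (by linarith)]
        exact one_le_pow₀ hn'
      simpa only [mul_comm] using h1.trans_isBigO h2
    · rw [h1]
      apply Asymptotics.IsBigO.mul_isLittleO (Asymptotics.isBigO_refl _ _)
      exact (Asymptotics.isLittleO_pow_pow_atTop_of_lt h2).comp_tendsto tendsto_natCast_atTop_atTop
  have hb := ho.bound (half_pos hf)
  filter_upwards [hb, Filter.eventually_ge_atTop 1] with n hn hn1
  rw [← Finset.add_sum_erase s _ hm]
  have hn' : (0 : ℝ) < (n : ℝ) := by exact_mod_cast hn1
  have hE : 0 < β m ^ n * (n : ℝ) ^ κ m := by positivity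
  rw [Real.norm_of_nonneg hE.le, Real.norm_eq_abs] at hn
  have := (abs_le.1 hn).1
  nlinarith [mul_pos hf hE]

lemma sign_span (val : B →ₐ[K] ℝ) (hval : Function.Injective val) (u : ℕ → B)
    (hu : u ∈ Submodule.span B ((fun p : K × ℕ => pe B p.1 p.2) '' {p | 0 < algebraMap K ℝ p.1})) :
    ∀ᶠ g : B → ℝ in nhds (fun b : B => val b), ∀ ψ : B →ₐ[K] ℝ, (g = fun b => ψ b) →
      ∀ᶠ n in Filter.atTop, SignType.sign (ψ (u n)) = SignType.sign (val (u n)) := by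
  classical
  obtain ⟨l, hl, rfl⟩ := (Finsupp.mem_span_image_iff_linearCombination B).1 hu
  have hform : ∀ (ψ : B →ₐ[K] ℝ) (n : ℕ),
      ψ (Finsupp.linearCombination B (fun p : K × ℕ => pe B p.1 p.2) l n) =
      ∑ i ∈ l.support, ψ (l i) * ((algebraMap K ℝ i.1) ^ n * (n : ℝ) ^ i.2) := by
    intro ψ n
    rw [Finsupp.linearCombination_apply, Finsupp.sum, Finset.sum_apply, map_sum]
    refine Finset.sum_congr rfl fun i _ => ?_
    simp [pe]
  by_cases h0 : l.support = ∅
  · refine Filter.Eventually.of_forall fun g ψ _ => Filter.Eventually.of_forall fun n => ?_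
    rw [hform, hform, h0]; simp
  obtain ⟨m, hm, hmax⟩ := Finset.exists_max_image l.support
    (fun i => toLex ((algebraMap K ℝ i.1 : ℝ), i.2)) (Finset.nonempty_of_ne_empty h0)
  have hβ : ∀ i ∈ l.support, 0 < algebraMap K ℝ i.1 := fun i hi => hl hi
  have hlt : ∀ i ∈ l.support, i ≠ m → algebraMap K ℝ i.1 < algebraMap K ℝ m.1 ∨
      (algebraMap K ℝ i.1 = algebraMap K ℝ m.1 ∧ i.2 < m.2) := by
    intro i hi hne
    have := hmax i hi
    rw [Prod.Lex.toLex_le_toLex] at this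
    rcases this with h | ⟨h, h'⟩
    · exact Or.inl h
    · refine Or.inr ⟨h, lt_of_le_of_ne h' fun h2 => hne ?_⟩
      exact Prod.ext ((algebraMap K ℝ).injective h) h2
  have hlm : val (l m) ≠ 0 := by
    intro h
    rw [map_eq_zero_iff _ hval] at h
    exact (Finsupp.mem_support_iff.1 hm) h
  have hpos : ∀ ψ : B →ₐ[K] ℝ, 0 < ψ (l m) → ∀ᶠ n in Filter.atTop,
      0 < ψ (Finsupp.linearCombination B (fun p : K × ℕ => pe B p.1 p.2) l n) := by
    intro ψ h
    simp only [hform]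
    exact dominant l.support (fun i => algebraMap K ℝ i.1) (fun i => i.2) (fun i => ψ (l i)) m hm
      hβ hlt h
  have hneg : ∀ ψ : B →ₐ[K] ℝ, ψ (l m) < 0 → ∀ᶠ n in Filter.atTop,
      ψ (Finsupp.linearCombination B (fun p : K × ℕ => pe B p.1 p.2) l n) < 0 := by
    intro ψ h
    simp only [hform]
    have := dominant l.support (fun i => algebraMap K ℝ i.1) (fun i => i.2) (fun i => -ψ (l i)) m hm
      hβ hlt (by simpa using h)
    simpa only [neg_mul, Finset.sum_neg_distrib, Left.neg_pos_iff] using this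
  rcases lt_or_gt_of_ne hlm with h | h
  · have hev : ∀ᶠ g : B → ℝ in nhds (fun b : B => val b), g (l m) < 0 :=
      (continuous_apply (l m)).continuousAt.eventually_lt continuousAt_const h
    filter_upwards [hev] with g hg ψ hψ
    subst hψ
    filter_upwards [hneg ψ hg, hneg val h] with n h1 h2
    rw [sign_neg h1, sign_neg h2]
  · have hev : ∀ᶠ g : B → ℝ in nhds (fun b : B => val b), 0 < g (l m) :=
      continuousAt_const.eventually_lt (continuous_apply (l m)).continuousAt h
    filter_upwards [hev] with g hg ψ hψ
    subst hψ
    filter_upwards [hpos ψ hg, hpos val h] with n h1 h2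
    rw [sign_pos h1, sign_pos h2]

lemma subseq_mem (r : ℕ) {u : ℕ → B} (hu : u ∈ peSpan K B) :
    (fun n => u (2 * n + r)) ∈
      Submodule.span B ((fun p : K × ℕ => pe B p.1 p.2) '' {p | 0 < algebraMap K ℝ p.1}) := by
  unfold peSpan at hu
  induction hu using Submodule.span_induction with
  | zero => exact Submodule.zero_mem _
  | add x y _ _ hx hy => exact add_mem hx hy
  | smul a x _ hx => exact Submodule.smul_mem _ a hx
  | mem x hx =>
    obtain ⟨b, hb, k, rfl⟩ := hx
    have : (fun n => pe B b k (2 * n + r)) = ∑ j ∈ Finset.range (k + 1),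
        algebraMap K B (b ^ r * 2 ^ j * (r : K) ^ (k - j) * (k.choose j : K)) • pe B (b ^ 2) j := by
      funext n
      simp only [Finset.sum_apply, Pi.smul_apply, smul_eq_mul, pe, ← map_mul, ← map_sum]
      congr 1
      push_cast
      rw [add_pow, Finset.mul_sum]
      refine Finset.sum_congr rfl fun j _ => ?_
      rw [mul_pow, pow_add, pow_mul]
      ring
    rw [this]
    refine sum_mem fun j _ => Submodule.smul_mem _ _ (Submodule.subset_span ⟨(b ^ 2, j), ?_, rfl⟩)
    have : algebraMap K ℝ b ≠ 0 := by simpa using hb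
    show 0 < algebraMap K ℝ (b ^ 2)
    rw [map_pow]
    positivity

lemma PE_sign (val : B →ₐ[K] ℝ) (hval : Function.Injective val) (u : ℕ → B) (hu : u ∈ PE K B) :
    ∀ᶠ g : B → ℝ in nhds (fun b : B => val b), ∀ ψ : B →ₐ[K] ℝ, (g = fun b => ψ b) →
      ∀ᶠ n in Filter.atTop, SignType.sign (ψ (u n)) = SignType.sign (val (u n)) := by
  obtain ⟨v, hv, huv⟩ := hu
  filter_upwards [sign_span val hval _ (subseq_mem 0 hv), sign_span val hval _ (subseq_mem 1 hv)]
    with g h0 h1 ψ hψ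
  obtain ⟨N0, hN0⟩ := Filter.eventually_atTop.1 (h0 ψ hψ)
  obtain ⟨N1, hN1⟩ := Filter.eventually_atTop.1 (h1 ψ hψ)
  filter_upwards [huv, Filter.eventually_ge_atTop (2 * N0 + 2 * N1 + 2)] with n hn hge
  rw [hn]
  rcases Nat.even_or_odd' n with ⟨m, rfl | rfl⟩
  · exact hN0 m (by omega)
  · exact hN1 m (by omega)

end PolyExp

lemma orbit_PE {K B : Type*} [Field K] [CharZero K] [CommRing B] [Algebra K B] {d : ℕ}
    (a' : Fin d → MvPolynomial (Fin d) K) (r : Fin d → Fin d → Prop) (hr : WellFounded r)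
    (h : ∀ i, ∃ (c : K) (p : MvPolynomial (Fin d) K), a' i = C c * X i + p ∧ ∀ j ∈ p.vars, r j i)
    (x : ℕ → Fin d → B) (hx : ∀ n i, x (n + 1) i = aeval (x n) (a' i)) (i : Fin d) :
    (fun n => x n i) ∈ PE K B := by
  classical
  induction i using hr.induction with
  | _ i ih =>
  obtain ⟨c, p, hp, hv⟩ := h i
  refine PE_rec c (p := fun n => aeval (x n) p) ?_ (fun n => ?_)
  · have := PE_aeval (K := K) (fun j => if j ∈ p.vars then (fun n => x n j) else (0 : ℕ → B))
      (fun j => by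
        split_ifs with hj
        · exact ih j (hv j hj)
        · exact zero_mem _) p
    convert! this using 2 with n
    refine eval₂Hom_congr' rfl (fun j hj _ => ?_) rfl
    simp [hj]
  · rw [hx, hp]
    simp

lemma descend {d : ℕ} (p : MvPolynomial (Fin d) ℝ) (h : ∀ mono, IsAlgebraic ℚ (coeff mono p)) :
    ∃ p' : MvPolynomial (Fin d) RA, map (algebraMap RA ℝ) p' = p := by
  have : p ∈ Set.range (MvPolynomial.map (σ := Fin d) (algebraMap RA ℝ)) := by
    rw [mem_range_map_iff_coeffs_subset]
    intro y hy
    obtain ⟨m, _, rfl⟩ := mem_coeffs_iff.1 hy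
    exact ⟨⟨_, mem_algebraicClosure_iff.2 (h m)⟩, rfl⟩
  exact this

lemma twn_struct {d : ℕ} (a : Fin d → MvPolynomial (Fin d) ℝ)
    (a' : Fin d → MvPolynomial (Fin d) RA) (ha : ∀ i, map (algebraMap RA ℝ) (a' i) = a i)
    (hwnl : ∀ i, ∃ (ci : ℝ) (pi : MvPolynomial (Fin d) ℝ),
      i ∉ pi.vars ∧ a i = ci • X i + pi) (i : Fin d) :
    ∃ (c : RA) (p : MvPolynomial (Fin d) RA), a' i = C c * X i + p ∧
      ∀ j ∈ p.vars, Function.swap (depRel a) j i := by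
  classical
  obtain ⟨ci, pi, hi, hai⟩ := hwnl i
  have hc : coeff (Finsupp.single i 1) pi = 0 := by
    by_contra h
    apply hi
    rw [mem_vars]
    exact ⟨_, mem_support_iff.2 h, by simp⟩
  have hci : algebraMap RA ℝ (coeff (Finsupp.single i 1) (a' i)) = ci := by
    rw [← coeff_map, ha, hai, coeff_add, hc, coeff_smul, coeff_X]
    simp
  refine ⟨coeff (Finsupp.single i 1) (a' i), a' i - C (coeff (Finsupp.single i 1) (a' i)) * X i,
    by ring, fun j hj => ?_⟩
  have hmap : map (algebraMap RA ℝ) (a' i - C (coeff (Finsupp.single i 1) (a' i)) * X i) = pi := by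
    rw [map_sub, map_mul, map_C, map_X, ha, hci, hai, smul_eq_C_mul]
    ring
  rw [← vars_map_of_injective _ (algebraMap RA ℝ).injective, hmap] at hj
  have hne : i ≠ j := by rintro rfl; exact hi hj
  refine Relation.TransGen.single ⟨hne, ?_⟩
  have e : pi = a i - C ci * X i := by rw [hai, smul_eq_C_mul]; ring
  rw [e] at hj
  rcases Finset.mem_union.1 (vars_sub_subset _ hj) with h | h
  · exact h
  · have := vars_mul _ _ h
    simp at this
    exact absurd this.symm hne

lemma depRel_swap_wf {d : ℕ} (a : Fin d → MvPolynomial (Fin d) ℝ)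
    (hwf : WellFounded (depRel a)) : WellFounded (Function.swap (depRel a)) := by
  have h1 : IsTrans (Fin d) (Function.swap (depRel a)) :=
    ⟨fun x y z h h' => Relation.TransGen.trans h' h⟩
  have h2 : Std.Irrefl (Function.swap (depRel a)) := ⟨fun x h => hwf.irrefl.irrefl x h⟩
  exact Finite.wellFounded_of_trans_of_irrefl _

/-- The orbit inside an algebra. -/
noncomputable def orb {K B : Type*} [CommRing K] [CommRing B] [Algebra K B] {d : ℕ}
    (a' : Fin d → MvPolynomial (Fin d) K) (x : Fin d → B) : ℕ → Fin d → B
  | 0 => x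
  | n + 1 => fun i => aeval (orb a' x n) (a' i)

lemma eval_hom {K B : Type*} [CommRing K] [CommRing B] [Algebra K B] [Algebra K ℝ] {d : ℕ}
    (p' : MvPolynomial (Fin d) K) (ψ : B →ₐ[K] ℝ) (x : Fin d → B) :
    eval (fun i => ψ (x i)) (map (algebraMap K ℝ) p') = ψ (aeval x p') := by
  rw [eval_map, ← aeval_def, ← MvPolynomial.comp_aeval_apply]

lemma orb_hom {K B : Type*} [CommRing K] [CommRing B] [Algebra K B] [Algebra K ℝ] {d : ℕ}
    (a : Fin d → MvPolynomial (Fin d) ℝ)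
    (a' : Fin d → MvPolynomial (Fin d) K) (ha : ∀ i, map (algebraMap K ℝ) (a' i) = a i)
    (ψ : B →ₐ[K] ℝ) (x : Fin d → B) (n : ℕ) :
    (updMap a)^[n] (fun i => ψ (x i)) = fun i => ψ (orb a' x n i) := by
  induction n with
  | zero => rfl
  | succ n ih =>
    rw [Function.iterate_succ_apply', ih]
    funext i
    rw [updMap, ← ha, eval_hom]
    rfl

/-- A twn-loop with algebraic coefficients is non-terminating over ℝ iff it is
non-terminating over the real algebraic numbers; i.e., it terminates over the real
algebraic numbers iff it terminates over ℝ. -/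
theorem twn_termination_algebraic_iff_real {d : ℕ} (hd : 1 ≤ d)
    (a : Fin d → MvPolynomial (Fin d) ℝ)
    (hwf : WellFounded (depRel a))
    (hwnl : ∀ i, ∃ (ci : ℝ) (pi : MvPolynomial (Fin d) ℝ),
      i ∉ pi.vars ∧ a i = ci • X i + pi)
    (halg : ∀ (i : Fin d) (mono : Fin d →₀ ℕ), IsAlgebraic ℚ (coeff mono (a i)))
    (S : Set (Fin d → ℝ)) (hS : IsAlgDNFGuard S) :
    (∃ c : Fin d → ℝ, ∀ n : ℕ, (updMap a)^[n] c ∈ S) ↔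
      (∃ c : Fin d → ℝ, (∀ i, IsAlgebraic ℚ (c i)) ∧ ∀ n : ℕ, (updMap a)^[n] c ∈ S) := by
  classical
  refine ⟨?_, fun ⟨c, _, h⟩ => ⟨c, h⟩⟩
  rintro ⟨c, hc⟩
  obtain ⟨m, k, p, strict, hp, rfl⟩ := hS
  choose a' ha using fun i => descend (a i) (halg i)
  choose p' hp' using fun i j => descend (p i j) (hp i j)
  obtain ⟨B, hB, hcB⟩ : ∃ B : Subalgebra RA ℝ, ALprop B ∧ ∀ i, c i ∈ B :=
    ⟨_, AL_adjoin (Finset.univ.image c), fun i => Algebra.subset_adjoin (by simp)⟩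
  let x : Fin d → B := fun i => ⟨c i, hcB i⟩
  have hPE : ∀ i, (fun n => orb a' x n i) ∈ PE RA B :=
    orbit_PE a' _ (depRel_swap_wf a hwf) (twn_struct a a' ha hwnl) (orb a' x) (fun n i => rfl)
  have hPE2 : ∀ i j, (fun n => aeval (orb a' x n) (p' i j)) ∈ PE RA B :=
    fun i j => PE_aeval (fun i n => orb a' x n i) hPE (p' i j)
  have hsign := fun i j => PE_sign B.val Subtype.val_injective _ (hPE2 i j)
  have hall : ∀ᶠ g : B → ℝ in nhds (fun b : B => B.val b), ∀ i j, ∀ ψ : B →ₐ[RA] ℝ,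
      (g = fun b => ψ b) → ∀ᶠ n in Filter.atTop,
        SignType.sign (ψ (aeval (orb a' x n) (p' i j))) =
          SignType.sign (B.val (aeval (orb a' x n) (p' i j))) :=
    Filter.eventually_all.2 fun i => Filter.eventually_all.2 fun j => hsign i j
  obtain ⟨g, ⟨ψ, hψ, hg⟩, hgs⟩ := ((mem_closure_iff_frequently.1 hB).and_eventually hall).exists
  have hev : ∀ᶠ n in Filter.atTop, ∀ i j,
        SignType.sign (ψ (aeval (orb a' x n) (p' i j))) =
          SignType.sign (B.val (aeval (orb a' x n) (p' i j))) :=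
    Filter.eventually_all.2 fun i => Filter.eventually_all.2 fun j => hgs i j ψ hg
  obtain ⟨N, hN⟩ := Filter.eventually_atTop.1 hev
  have hval : c = fun i => B.val (x i) := rfl
  refine ⟨fun i => ψ (orb a' x N i), fun i => mem_algebraicClosure_iff.1 (hψ _), fun n => ?_⟩
  rw [← orb_hom a a' ha ψ x N, ← Function.iterate_add_apply, orb_hom a a' ha]
  have hn := hc (n + N)
  rw [hval, orb_hom a a' ha] at hn
  simp only [Set.mem_iUnion, Set.mem_iInter, Set.mem_setOf_eq] at hn ⊢
  obtain ⟨i, hi⟩ := hn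
  refine ⟨i, fun j => ?_⟩
  have h1 := hi j
  have h2 := hN (n + N) (by omega) i j
  rw [← hp', eval_hom] at h1 ⊢
  split_ifs at h1 ⊢
  · rwa [← sign_eq_one_iff, h2, sign_eq_one_iff]
  · rwa [← sign_nonneg_iff, h2, sign_nonneg_iff]
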